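/- Let Γ be a smooth solution of the Yang–Mills flow on ℝⁿ × [0,T) such that there is a compact set K ⊂ ℝⁿ with supp Γ_t ⊆ K for every t. Then for every z₀ = (x₀,t₀) with t₀ ∈ (0,T) and all 0 < ρ ≤ r < √t₀/2 one has Ψ_{z₀}(ρ;Γ) ≤ Ψ_{z₀}(r;Γ). -/

import Mathlib

open MeasureTheory Filter Set
open scoped ContDiff ENNReal

noncomputable section

abbrev Mat (k : ℕ) := Fin k → Fin k → ℝ

def mmul {k : ℕ} (A B : Mat k) : Mat k := fun i j => ∑ l, A i l * B l j

def mbra {k : ℕ} (A B : Mat k) : Mat k := mmul A B - mmul B A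

def minner {k : ℕ} (A B : Mat k) : ℝ := ∑ i, ∑ j, A i j * B i j

def msq {k : ℕ} (A : Mat k) : ℝ := minner A A

abbrev Conn (n k : ℕ) := ℝ → (Fin n → ℝ) → Fin n → Mat k

/-- Spatial partial derivative in the `i`-th coordinate direction. -/
def pd {n : ℕ} {E : Type*} [NormedAddCommGroup E] [NormedSpace ℝ E]
    (f : (Fin n → ℝ) → E) (x : Fin n → ℝ) (i : Fin n) : E :=
  fderiv ℝ f x (Pi.single i 1)

/-- Time derivative of a time-dependent connection. -/
def tderiv {n k : ℕ} (Γ : Conn n k) (t : ℝ) (x : Fin n → ℝ) (j : Fin n) : Mat k :=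
  deriv (fun s => Γ s x j) t

/-- Curvature `(F_t)_{ij} = ∂_i(Γ_t)_j − ∂_j(Γ_t)_i + [(Γ_t)_i,(Γ_t)_j]`. -/
def curv {n k : ℕ} (Γ : Conn n k) (t : ℝ) (x : Fin n → ℝ) (i j : Fin n) : Mat k :=
  pd (fun y => Γ t y j) x i - pd (fun y => Γ t y i) x j + mbra (Γ t x i) (Γ t x j)

/-- Covariant derivative `∇_i om = ∂_i om + [(Γ_t)_i, om]`. -/
def covD {n k : ℕ} (Γ : Conn n k) (t : ℝ) (om : (Fin n → ℝ) → Mat k)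
    (x : Fin n → ℝ) (i : Fin n) : Mat k :=
  pd om x i + mbra (Γ t x i) (om x)

/-- A smooth time-dependent connection: jointly smooth in `(t,x)`, with values in the
skew-symmetric matrices `𝔤`. -/
def IsSmoothConn {n k : ℕ} (Γ : Conn n k) : Prop :=
  ContDiff ℝ ∞ (fun p : ℝ × (Fin n → ℝ) => Γ p.1 p.2)
    ∧ ∀ t x i a b, Γ t x i b a = - (Γ t x i a b)

/-- The Yang–Mills flow equation `∂_t(Γ_t)_j = Σᵢ ∇_i(F_t)_{ij}` on a time interval `I`. -/
def IsYMFlowOn {n k : ℕ} (Γ : Conn n k) (I : Set ℝ) : Prop :=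
  ∀ t ∈ I, ∀ x j, tderiv Γ t x j = ∑ i, covD Γ t (fun y => curv Γ t y i j) x i

/-- `|F_t|²(x) = Σ_{i,j} |(F_t)_{ij}(x)|²`. -/
def normF2 {n k : ℕ} (Γ : Conn n k) (t : ℝ) (x : Fin n → ℝ) : ℝ :=
  ∑ i, ∑ j, msq (curv Γ t x i j)

/-- The backwards heat kernel `G_{z₀}(x,t)` based at `z₀ = (x₀,t₀)`. -/
def gauss {n : ℕ} (z0 : (Fin n → ℝ) × ℝ) (x : Fin n → ℝ) (t : ℝ) : ℝ :=
  (4 * Real.pi * (z0.2 - t)) ^ (-(n : ℝ) / 2) *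
    Real.exp (-(∑ i, (x i - z0.1 i) ^ 2) / (4 * (z0.2 - t)))

/-- The entropy `Φ_{z₀}(R;Γ)`. -/
def Phi {n k : ℕ} (Γ : Conn n k) (z0 : (Fin n → ℝ) × ℝ) (R : ℝ) : ℝ :=
  R ^ 4 / 2 * ∫ x : Fin n → ℝ, normF2 Γ (z0.2 - R ^ 2) x * gauss z0 x (z0.2 - R ^ 2)

/-- The entropy `Ψ_{z₀}(R;Γ)`. -/
def Psi {n k : ℕ} (Γ : Conn n k) (z0 : (Fin n → ℝ) × ℝ) (R : ℝ) : ℝ :=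
  R ^ 2 / 2 * ∫ t in Icc (z0.2 - 4 * R ^ 2) (z0.2 - R ^ 2),
    ∫ x : Fin n → ℝ, normF2 Γ t x * gauss z0 x t

/-- The parabolically rescaled connection `Γ^{λ,z₀}`. -/
def rescale {n k : ℕ} (Γ : Conn n k) (z0 : (Fin n → ℝ) × ℝ) (lam : ℝ) : Conn n k :=
  fun t x i => lam • Γ (lam ^ 2 * t + z0.2) (fun m => lam * x m + z0.1 m) i

/-- Spatial support of `Γ_t` contained in `K` for all `t`. -/
def SuppIn {n k : ℕ} (Γ : Conn n k) (K : Set (Fin n → ℝ)) : Prop :=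
  ∀ t x, x ∉ K → Γ t x = 0

section MatrixAlgebra

variable {k : ℕ}

/-- The matrix product as a continuous bilinear map. -/
def mmulL (k : ℕ) : Mat k →L[ℝ] Mat k →L[ℝ] Mat k :=
  (LinearMap.mk₂ ℝ (mmul (k := k))
    (fun A B C => by ext i j; simp [mmul, add_mul, Finset.sum_add_distrib])
    (fun c A B => by ext i j; simp [mmul, Finset.mul_sum, mul_assoc])
    (fun A B C => by ext i j; simp [mmul, mul_add, Finset.sum_add_distrib])
    (fun c A B => by ext i j; simp [mmul, Finset.mul_sum, mul_left_comm])).toContinuousBilinearMap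

@[simp] lemma mmulL_apply (A B : Mat k) : mmulL k A B = mmul A B := rfl

/-- The commutator as a continuous bilinear map. -/
def mbraL (k : ℕ) : Mat k →L[ℝ] Mat k →L[ℝ] Mat k := mmulL k - (mmulL k).flip

@[simp] lemma mbraL_apply (A B : Mat k) : mbraL k A B = mbra A B := rfl

/-- The trace inner product as a continuous bilinear map. -/
def minnerL (k : ℕ) : Mat k →L[ℝ] Mat k →L[ℝ] ℝ :=
  (LinearMap.mk₂ ℝ (minner (k := k))
    (fun A B C => by simp [minner, add_mul, Finset.sum_add_distrib])
    (fun c A B => by simp [minner, Finset.mul_sum, mul_assoc])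
    (fun A B C => by simp [minner, mul_add, Finset.sum_add_distrib])
    (fun c A B => by simp [minner, Finset.mul_sum, mul_left_comm])).toContinuousBilinearMap

@[simp] lemma minnerL_apply (A B : Mat k) : minnerL k A B = minner A B := rfl

lemma minner_comm (A B : Mat k) : minner A B = minner B A := by
  simp [minner, mul_comm]

lemma minner_self_nonneg (A : Mat k) : 0 ≤ minner A A :=
  Finset.sum_nonneg fun _ _ => Finset.sum_nonneg fun _ _ => mul_self_nonneg _

lemma minner_add_left (A B C : Mat k) : minner (A + B) C = minner A C + minner B C := by
  simp [← minnerL_apply]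

lemma minner_add_right (A B C : Mat k) : minner A (B + C) = minner A B + minner A C := by
  simp [← minnerL_apply]

lemma minner_sub_left (A B C : Mat k) : minner (A - B) C = minner A C - minner B C := by
  simp [← minnerL_apply]

lemma minner_sub_right (A B C : Mat k) : minner A (B - C) = minner A B - minner A C := by
  simp [← minnerL_apply]

lemma minner_neg_right (A B : Mat k) : minner A (-B) = -minner A B := by
  simp [← minnerL_apply]

lemma minner_smul_left (c : ℝ) (A B : Mat k) : minner (c • A) B = c * minner A B := by
  simp [← minnerL_apply]

lemma minner_smul_right (c : ℝ) (A B : Mat k) : minner A (c • B) = c * minner A B := by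
  simp [← minnerL_apply]

lemma minner_sum_left {ι : Type*} (s : Finset ι) (f : ι → Mat k) (B : Mat k) :
    minner (∑ i ∈ s, f i) B = ∑ i ∈ s, minner (f i) B := by
  simp [← minnerL_apply]

lemma minner_sum_right {ι : Type*} (s : Finset ι) (A : Mat k) (f : ι → Mat k) :
    minner A (∑ i ∈ s, f i) = ∑ i ∈ s, minner A (f i) := by
  simp [← minnerL_apply]

lemma mmul_assoc (A B C : Mat k) : mmul (mmul A B) C = mmul A (mmul B C) :=
  Matrix.mul_assoc (n := Fin k) (α := ℝ) A B C

lemma mmul_add (A B C : Mat k) : mmul A (B + C) = mmul A B + mmul A C := by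
  simp [← mmulL_apply]

lemma add_mmul (A B C : Mat k) : mmul (A + B) C = mmul A C + mmul B C := by
  simp [← mmulL_apply]

lemma mmul_sub (A B C : Mat k) : mmul A (B - C) = mmul A B - mmul A C := by
  simp [← mmulL_apply]

lemma sub_mmul (A B C : Mat k) : mmul (A - B) C = mmul A C - mmul B C := by
  simp [← mmulL_apply]

/-- The adjoint action of a skew matrix is skew for the trace inner product. -/
lemma minner_mbra_add {A : Mat k} (hA : ∀ a b, A b a = -A a b) (B C : Mat k) :
    minner (mbra A B) C + minner B (mbra A C) = 0 := by
  have h1 : minner (mmul A B) C = -minner B (mmul A C) := by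
    simp only [minner, mmul, Finset.sum_mul, Finset.mul_sum, ← Finset.sum_neg_distrib]
    rw [Finset.sum_congr rfl fun _ _ => Finset.sum_comm, Finset.sum_comm]
    refine Finset.sum_congr rfl fun i _ => ?_
    rw [Finset.sum_comm]
    refine Finset.sum_congr rfl fun j _ => Finset.sum_congr rfl fun l _ => ?_
    rw [hA i l]; ring
  have h2 : minner (mmul B A) C = -minner B (mmul C A) := by
    simp only [minner, mmul, Finset.sum_mul, Finset.mul_sum, ← Finset.sum_neg_distrib]
    refine Finset.sum_congr rfl fun i _ => ?_
    rw [Finset.sum_comm]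
    refine Finset.sum_congr rfl fun j _ => Finset.sum_congr rfl fun l _ => ?_
    rw [hA l j]; ring
  simp only [mbra, minner_sub_left, minner_sub_right, h1, h2]
  ring

/-- The pointwise algebra behind the monotonicity formula: `F` plays the role of the curvature,
`N l i j` of `∇_l F_{ij}`, `B i j` of `∇_i (∂_t Γ)_j`, `a` of `(x - x₀) / (2 (t₀ - t))` and
`c` of `1 / (2 (t₀ - t))`. -/
lemma curvature_divergence_algebra {n : ℕ} (F : Fin n → Fin n → Mat k)
    (N : Fin n → Fin n → Fin n → Mat k) (A : Fin n → Mat k) (B : Fin n → Fin n → Mat k)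
    (a : Fin n → ℝ) (c : ℝ)
    (hF : ∀ i j, F j i = -F i j) (hN : ∀ l i j, N l j i = -N l i j)
    (hB : ∀ l i j, N l i j + N i j l + N j l i = 0) (hA : ∀ j, A j = ∑ i, N i i j)
    (W : Fin n → Mat k) (hW : ∀ j, W j = A j - ∑ l, a l • F l j)
    (q : ℝ) (hq : q = ∑ i, ∑ j, minner (F i j) (F i j)) :
    (∑ i, ∑ j, 2 * minner (B i j - B j i) (F i j)) + q * (n * c - ∑ i, a i ^ 2) =
      4 * c * q - 4 * ∑ j, minner (W j) (W j) +
      ∑ i, ((4 * ∑ j, (minner (N i i j) (W j) +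
          minner (F i j) (B i j - (c • F i j + ∑ l, a l • N i l j)))) +
        ((∑ j, ∑ m, 2 * minner (N i j m) (F j m)) * a i + q * c) -
        a i * (4 * (∑ j, minner (F i j) (W j)) + q * a i)) := by
  have s1 : ∑ i, ∑ j, 2 * minner (B i j - B j i) (F i j) =
      4 * ∑ i, ∑ j, minner (F i j) (B i j) := by
    have : ∑ i, ∑ j, minner (B j i) (F i j) = -∑ i, ∑ j, minner (F i j) (B i j) := by
      rw [Finset.sum_comm]
      simp only [← Finset.sum_neg_distrib]
      refine Finset.sum_congr rfl fun i _ => Finset.sum_congr rfl fun j _ => ?_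
      rw [hF i j, minner_neg_right, minner_comm]
    simp only [minner_sub_left, ← Finset.mul_sum, Finset.sum_sub_distrib, this]
    simp only [minner_comm (B _ _)]
    ring
  have s2 : ∑ i, ∑ j, minner (N i i j) (W j) = ∑ j, minner (A j) (W j) := by
    rw [Finset.sum_comm]
    simp only [hA, minner_sum_left]
  have s3 : ∑ i, a i * ∑ j, minner (F i j) (W j) =
      ∑ j, minner (∑ l, a l • F l j) (W j) := by
    simp only [Finset.mul_sum, minner_sum_left, minner_smul_left]
    rw [Finset.sum_comm]
  have s4 : ∑ j, minner (W j) (W j) =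
      ∑ j, minner (A j) (W j) - ∑ j, minner (∑ l, a l • F l j) (W j) := by
    rw [← Finset.sum_sub_distrib]
    refine Finset.sum_congr rfl fun j _ => ?_
    rw [← minner_sub_left, ← hW]
  have s5 : ∀ l, ∑ i, ∑ j, minner (N l i j) (F i j) =
      2 * ∑ i, ∑ j, minner (F i j) (N i l j) := by
    intro l
    have h1 : ∀ i j, N l i j = N i l j - N j l i := by
      intro i j
      have := hB l i j
      rw [hN i l j] at this
      rw [eq_sub_iff_add_eq, ← sub_eq_zero, ← this]; abel
    have h2 : ∑ i, ∑ j, minner (N j l i) (F i j) = -∑ i, ∑ j, minner (F i j) (N i l j) := by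
      rw [Finset.sum_comm]
      simp only [← Finset.sum_neg_distrib]
      refine Finset.sum_congr rfl fun i _ => Finset.sum_congr rfl fun j _ => ?_
      rw [hF i j, minner_neg_right, minner_comm]
    simp only [h1 _ _, minner_sub_left, Finset.sum_sub_distrib, h2]
    simp only [minner_comm (N _ _ _)]
    ring
  have s6 : ∑ i, ∑ j, minner (F i j) (∑ l, a l • N i l j) =
      ∑ l, a l * ∑ i, ∑ j, minner (F i j) (N i l j) := by
    simp only [minner_sum_right, minner_smul_right, Finset.mul_sum]
    rw [Finset.sum_congr rfl fun _ _ => Finset.sum_comm, Finset.sum_comm]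
  have s7 : ∑ i, (2 * ∑ j, ∑ m, minner (N i j m) (F j m)) * a i =
      4 * ∑ l, a l * ∑ i, ∑ j, minner (F i j) (N i l j) := by
    simp only [s5]
    rw [Finset.mul_sum]
    exact Finset.sum_congr rfl fun _ _ => by ring
  have s8 : ∑ i, a i * (4 * (∑ j, minner (F i j) (W j)) + q * a i) =
      4 * (∑ i, a i * ∑ j, minner (F i j) (W j)) + q * ∑ i, a i ^ 2 := by
    rw [Finset.mul_sum, Finset.mul_sum, ← Finset.sum_add_distrib]
    exact Finset.sum_congr rfl fun _ _ => by ring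
  have s9 : ∑ i, ∑ j, minner (F i j) (c • F i j) = c * q := by
    simp only [hq, minner_smul_right, Finset.mul_sum]
  rw [s1]
  simp only [Finset.sum_sub_distrib, Finset.sum_add_distrib, ← Finset.mul_sum, s2,
    minner_sub_right, minner_add_right, s6, s7, s8, s9, s3, s4, Finset.sum_const,
    Finset.card_univ, Fintype.card_fin, nsmul_eq_mul]
  ring

end MatrixAlgebra

open scoped Topology

section DirectionalDerivative

variable {E F F₁ F₂ : Type*} [NormedAddCommGroup E] [NormedSpace ℝ E]
  [NormedAddCommGroup F] [NormedSpace ℝ F] [NormedAddCommGroup F₁] [NormedSpace ℝ F₁]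
  [NormedAddCommGroup F₂] [NormedSpace ℝ F₂]

/-- The derivative of `f` at `p` in the direction `v`. -/
def dirD (v : E) (f : E → F) (p : E) : F := fderiv ℝ f p v

lemma ContDiff.contDiff_dirD {f : E → F} (hf : ContDiff ℝ ∞ f) (v : E) : ContDiff ℝ ∞ (dirD v f) :=
  (hf.fderiv_right (m := ∞) (by simp)).clm_apply contDiff_const

lemma ContDiff.hasDerivAt_dirD {f : E → F} (hf : ContDiff ℝ ∞ f) {c : ℝ → E} {v : E} {s : ℝ}
    (hc : HasDerivAt c v s) : HasDerivAt (fun u => f (c u)) (dirD v f (c s)) s :=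
  ((hf.differentiable (by simp)).differentiableAt.hasFDerivAt).comp_hasDerivAt s hc

lemma dirD_comm {f : E → F} (hf : ContDiff ℝ ∞ f) (u v p : E) :
    dirD u (dirD v f) p = dirD v (dirD u f) p := by
  have hd : DifferentiableAt ℝ (fderiv ℝ f) p :=
    ((hf.fderiv_right (m := ∞) (by simp)).differentiable (by simp)).differentiableAt
  have h : ∀ a b, dirD a (dirD b f) p = fderiv ℝ (fderiv ℝ f) p a b := by
    intro a b
    have : HasFDerivAt (dirD b f) ((fderiv ℝ (fderiv ℝ f) p).flip b) p := by
      have := hd.hasFDerivAt.clm_apply (hasFDerivAt_const b p)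
      rwa [ContinuousLinearMap.comp_zero, zero_add] at this
    rw [dirD, this.fderiv]; rfl
  rw [h, h]
  exact (hf.contDiffAt.isSymmSndFDerivAt (by simpa using ENat.LEInfty.out)).eq u v

lemma dirD_bilin (L : F₁ →L[ℝ] F₂ →L[ℝ] F) {f : E → F₁} {g : E → F₂}
    (hf : ContDiff ℝ ∞ f) (hg : ContDiff ℝ ∞ g) (v p : E) :
    dirD v (fun q => L (f q) (g q)) p = L (dirD v f p) (g p) + L (f p) (dirD v g p) := by
  rw [dirD, (L.hasFDerivAt_of_bilinear (hf.differentiable (by simp)).differentiableAt.hasFDerivAt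
    (hg.differentiable (by simp)).differentiableAt.hasFDerivAt).fderiv]
  simp [dirD, add_comm]

lemma dirD_add {f g : E → F} (hf : ContDiff ℝ ∞ f) (hg : ContDiff ℝ ∞ g) (v p : E) :
    dirD v (fun q => f q + g q) p = dirD v f p + dirD v g p := by
  rw [dirD, fderiv_fun_add (hf.differentiable (by simp)).differentiableAt
    (hg.differentiable (by simp)).differentiableAt]
  rfl

lemma dirD_sub {f g : E → F} (hf : ContDiff ℝ ∞ f) (hg : ContDiff ℝ ∞ g) (v p : E) :
    dirD v (fun q => f q - g q) p = dirD v f p - dirD v g p := by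
  rw [dirD, fderiv_fun_sub (hf.differentiable (by simp)).differentiableAt
    (hg.differentiable (by simp)).differentiableAt]
  rfl

lemma dirD_neg (f : E → F) (v p : E) : dirD v (fun q => -f q) p = -dirD v f p := by
  rw [dirD, fderiv_fun_neg]
  rfl

lemma dirD_eq_zero_of_eventuallyEq {f : E → F} {p : E} (h : f =ᶠ[𝓝 p] fun _ => 0) (v : E) :
    dirD v f p = 0 := by
  rw [dirD, h.fderiv_eq]
  simp

end DirectionalDerivative

section Curvature

variable {n k : ℕ}

/-- The time direction in spacetime. -/
def timeDir (n : ℕ) : ℝ × (Fin n → ℝ) := (1, 0)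

/-- The `i`-th coordinate direction in spacetime. -/
def spaceDir (i : Fin n) : ℝ × (Fin n → ℝ) := (0, Pi.single i 1)

/-- The curvature as a function on spacetime. -/
def curvST (g : Fin n → ℝ × (Fin n → ℝ) → Mat k) (i j : Fin n) (p : ℝ × (Fin n → ℝ)) : Mat k :=
  dirD (spaceDir i) (g j) p - dirD (spaceDir j) (g i) p + mbra (g i p) (g j p)

/-- The spatial covariant derivative of a function on spacetime. -/
def covST (g : Fin n → ℝ × (Fin n → ℝ) → Mat k) (i : Fin n) (η : ℝ × (Fin n → ℝ) → Mat k)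
    (p : ℝ × (Fin n → ℝ)) : Mat k :=
  dirD (spaceDir i) η p + mbra (g i p) (η p)

lemma contDiff_mbra {E : Type*} [NormedAddCommGroup E] [NormedSpace ℝ E] {f g : E → Mat k}
    (hf : ContDiff ℝ ∞ f) (hg : ContDiff ℝ ∞ g) : ContDiff ℝ ∞ fun p => mbra (f p) (g p) :=
  ((mbraL k).contDiff.comp hf).clm_apply hg

lemma contDiff_minner {E : Type*} [NormedAddCommGroup E] [NormedSpace ℝ E] {f g : E → Mat k}
    (hf : ContDiff ℝ ∞ f) (hg : ContDiff ℝ ∞ g) : ContDiff ℝ ∞ fun p => minner (f p) (g p) :=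
  ((minnerL k).contDiff.comp hf).clm_apply hg

lemma dirD_mbra {E : Type*} [NormedAddCommGroup E] [NormedSpace ℝ E] {f g : E → Mat k}
    (hf : ContDiff ℝ ∞ f) (hg : ContDiff ℝ ∞ g) (v p : E) :
    dirD v (fun q => mbra (f q) (g q)) p = mbra (dirD v f p) (g p) + mbra (f p) (dirD v g p) :=
  dirD_bilin (mbraL k) hf hg v p

lemma hasDerivAt_minner {f h : ℝ → Mat k} {f' h' : Mat k} {s : ℝ} (hf : HasDerivAt f f' s)
    (hh : HasDerivAt h h' s) :
    HasDerivAt (fun u => minner (f u) (h u)) (minner f' (h s) + minner (f s) h') s := by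
  have := (minnerL k).hasDerivAt_of_bilinear (fun _ => hf) (fun _ => hh)
  simpa [add_comm] using this

/-- The trace inner product is parallel: ordinary derivatives may be replaced by covariant ones. -/
lemma hasDerivAt_minner_cov {A : Mat k} (hA : ∀ a b, A b a = -A a b)
    {f h : ℝ → Mat k} {f' h' : Mat k} {s : ℝ} (hf : HasDerivAt f f' s) (hh : HasDerivAt h h' s) :
    HasDerivAt (fun u => minner (f u) (h u))
      (minner (f' + mbra A (f s)) (h s) + minner (f s) (h' + mbra A (h s))) s := by
  convert hasDerivAt_minner hf hh using 1
  rw [minner_add_left, minner_add_right]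
  linear_combination minner_mbra_add hA (f s) (h s)

variable {g : Fin n → ℝ × (Fin n → ℝ) → Mat k}

lemma contDiff_curvST (hg : ∀ i, ContDiff ℝ ∞ (g i)) (i j : Fin n) :
    ContDiff ℝ ∞ (curvST g i j) :=
  (((hg j).contDiff_dirD _).sub ((hg i).contDiff_dirD _)).add (contDiff_mbra (hg i) (hg j))

lemma dirD_curvST (hg : ∀ i, ContDiff ℝ ∞ (g i)) (i j : Fin n) (v p : ℝ × (Fin n → ℝ)) :
    dirD v (curvST g i j) p =
      dirD v (dirD (spaceDir i) (g j)) p - dirD v (dirD (spaceDir j) (g i)) p +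
        (mbra (dirD v (g i) p) (g j p) + mbra (g i p) (dirD v (g j) p)) := by
  have := dirD_add (((hg j).contDiff_dirD (spaceDir i)).sub ((hg i).contDiff_dirD (spaceDir j)))
    (contDiff_mbra (hg i) (hg j)) v p
  rw [dirD_mbra (hg i) (hg j)] at this
  rw [← dirD_sub ((hg j).contDiff_dirD (spaceDir i)) ((hg i).contDiff_dirD (spaceDir j))]
  exact this

lemma curvST_swap (i j : Fin n) (p : ℝ × (Fin n → ℝ)) : curvST g j i p = -curvST g i j p := by
  simp only [curvST, mbra]; abel

lemma covST_curvST_swap (l i j : Fin n) (p : ℝ × (Fin n → ℝ)) :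
    covST g l (curvST g j i) p = -covST g l (curvST g i j) p := by
  have : curvST g j i = fun q => -curvST g i j q := funext fun q => curvST_swap i j q
  rw [covST, covST, this, dirD_neg, ← mbraL_apply, ← mbraL_apply, map_neg]
  abel

/-- The second Bianchi identity. -/
lemma bianchi (hg : ∀ i, ContDiff ℝ ∞ (g i)) (l i j : Fin n) (p : ℝ × (Fin n → ℝ)) :
    covST g l (curvST g i j) p + covST g i (curvST g j l) p + covST g j (curvST g l i) p = 0 := by
  simp only [covST, dirD_curvST hg]
  rw [dirD_comm (hg j) (spaceDir l) (spaceDir i), dirD_comm (hg l) (spaceDir i) (spaceDir j),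
    dirD_comm (hg i) (spaceDir j) (spaceDir l)]
  simp only [curvST, mbra, mmul_add, mmul_sub, add_mmul, sub_mmul, mmul_assoc]
  abel

/-- The evolution of the curvature: `∂_t F_{ij} = ∇_i (∂_t Γ)_j - ∇_j (∂_t Γ)_i`. -/
lemma dirD_curvST_eq_covST (hg : ∀ i, ContDiff ℝ ∞ (g i)) (i j : Fin n)
    (v p : ℝ × (Fin n → ℝ)) :
    dirD v (curvST g i j) p =
      covST g i (dirD v (g j)) p - covST g j (dirD v (g i)) p := by
  rw [dirD_curvST hg, dirD_comm (hg j), dirD_comm (hg i)]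
  simp only [covST, mbra]
  abel

end Curvature

section Gaussian

variable {n : ℕ} (x0 : Fin n → ℝ) (t0 : ℝ)

/-- The components of `(x - x₀) / (2 (t₀ - t))`, minus the logarithmic gradient of the backwards
heat kernel. -/
def drift (i : Fin n) (p : ℝ × (Fin n → ℝ)) : ℝ := (p.2 i - x0 i) / (2 * (t0 - p.1))

lemma gauss_nonneg (x : Fin n → ℝ) {t : ℝ} (ht : t < t0) : 0 ≤ gauss (x0, t0) x t := by
  have : 0 < t0 - t := sub_pos.2 ht
  unfold gauss
  positivity

lemma hasDerivAt_gauss_time (x : Fin n → ℝ) {t : ℝ} (ht : t < t0) :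
    HasDerivAt (fun s => gauss (x0, t0) x s)
      ((n * (1 / (2 * (t0 - t))) - ∑ i, drift x0 t0 i (t, x) ^ 2) * gauss (x0, t0) x t) t := by
  have hτ : 0 < t0 - t := sub_pos.2 ht
  have hb : HasDerivAt (fun s => 4 * Real.pi * (t0 - s)) (4 * Real.pi * (-1)) t :=
    ((hasDerivAt_id t).const_sub t0).const_mul _
  have hpos : 0 < 4 * Real.pi * (t0 - t) := by positivity
  have h1 := hb.rpow_const (p := -(n : ℝ) / 2) (Or.inl hpos.ne')
  have hc : HasDerivAt (fun s => 4 * (t0 - s)) (4 * (-1)) t :=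
    ((hasDerivAt_id t).const_sub t0).const_mul _
  have h2 := ((hasDerivAt_const t (-∑ i, (x i - x0 i) ^ 2)).fun_div hc (by positivity)).exp
  refine (h1.fun_mul h2).congr_deriv ?_
  have hsum : ∑ i, drift x0 t0 i (t, x) ^ 2 = (∑ i, (x i - x0 i) ^ 2) / (4 * (t0 - t) ^ 2) := by
    rw [Finset.sum_div]
    refine Finset.sum_congr rfl fun i _ => ?_
    simp only [drift]; rw [div_pow]; ring
  rw [hsum, Real.rpow_sub_one hpos.ne']
  simp only [gauss]
  have := Real.pi_pos.ne'
  field_simp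
  ring

lemma hasDerivAt_gauss_space (x : Fin n → ℝ) {t : ℝ} (ht : t < t0) (i : Fin n) :
    HasDerivAt (fun s : ℝ => gauss (x0, t0) (x + s • Pi.single i 1) t)
      (-drift x0 t0 i (t, x) * gauss (x0, t0) x t) 0 := by
  have hτ : 0 < t0 - t := sub_pos.2 ht
  have h1 : ∀ j, HasDerivAt (fun s : ℝ => ((x + s • (Pi.single i 1 : Fin n → ℝ)) j - x0 j) ^ 2)
      (2 * (x j - x0 j) * (Pi.single i (1 : ℝ) : Fin n → ℝ) j) 0 := by
    intro j
    have : HasDerivAt (fun s : ℝ => (x + s • (Pi.single i 1 : Fin n → ℝ)) j - x0 j)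
        ((Pi.single i (1 : ℝ) : Fin n → ℝ) j) 0 := by
      simpa using (((hasDerivAt_id (0 : ℝ)).mul_const
        ((Pi.single i (1 : ℝ) : Fin n → ℝ) j)).const_add (x j)).sub_const (x0 j)
    simpa using this.fun_pow 2
  have h2 := HasDerivAt.fun_sum (u := Finset.univ) fun j _ => h1 j
  have h3 := ((h2.fun_neg.div_const (4 * (t0 - t))).exp).const_mul
    ((4 * Real.pi * (t0 - t)) ^ (-(n : ℝ) / 2))
  refine h3.congr_deriv ?_
  simp only [gauss, drift, Pi.single_apply, zero_smul, add_zero, mul_ite, mul_one, mul_zero,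
    Finset.sum_ite_eq', Finset.mem_univ, if_true]
  field_simp
  ring

lemma contDiff_gauss (t : ℝ) : ContDiff ℝ ∞ fun x => gauss (x0, t0) x t := by
  unfold gauss
  fun_prop

lemma contDiff_drift (i : Fin n) (t : ℝ) : ContDiff ℝ ∞ fun x => drift x0 t0 i (t, x) := by
  simp only [drift, div_eq_mul_inv]
  fun_prop

lemma continuousOn_gauss :
    ContinuousOn (fun p : ℝ × (Fin n → ℝ) => gauss (x0, t0) p.2 p.1) {p | p.1 < t0} := by
  unfold gauss
  refine ContinuousOn.mul ?_ (Real.continuous_exp.comp_continuousOn ?_)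
  · refine ContinuousOn.rpow_const (by fun_prop) fun p hp => Or.inl ?_
    have : 0 < t0 - p.1 := sub_pos.2 hp
    positivity
  · refine ContinuousOn.div (by fun_prop) (by fun_prop) fun p hp => ?_
    have : 0 < t0 - p.1 := sub_pos.2 hp
    positivity

lemma continuousOn_drift (i : Fin n) : ContinuousOn (drift x0 t0 i) {p | p.1 < t0} := by
  unfold drift
  refine ContinuousOn.div (by fun_prop) (by fun_prop) fun p hp => ?_
  have : 0 < t0 - p.1 := sub_pos.2 hp
  positivity

lemma hasDerivAt_drift_space (x : Fin n → ℝ) (t : ℝ) (i l : Fin n) :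
    HasDerivAt (fun s : ℝ => drift x0 t0 l (t, x + s • Pi.single i 1))
      (if l = i then 1 / (2 * (t0 - t)) else 0) 0 := by
  have := ((((hasDerivAt_id (0 : ℝ)).mul_const
    ((Pi.single i (1 : ℝ) : Fin n → ℝ) l)).const_add (x l)).sub_const (x0 l)).div_const
      (2 * (t0 - t))
  refine this.congr_deriv ?_
  by_cases h : l = i <;> simp [h]

end Gaussian

section Flux

variable {n k : ℕ} (g : Fin n → ℝ × (Fin n → ℝ) → Mat k) (x0 : Fin n → ℝ) (t0 : ℝ)

/-- The squared norm of the curvature on spacetime. -/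
def curvSq (p : ℝ × (Fin n → ℝ)) : ℝ := ∑ i, ∑ j, minner (curvST g i j p) (curvST g i j p)

/-- The defect `∂_t Γ_j - Σ_l (x - x₀)_l / (2 (t₀ - t)) F_{lj}` from being a shrinking soliton. -/
def solitonDefect (j : Fin n) (p : ℝ × (Fin n → ℝ)) : Mat k :=
  dirD (timeDir n) (g j) p - ∑ l, drift x0 t0 l p • curvST g l j p

/-- The coefficient of the heat kernel in `energyFlux`. -/
def fluxCoeff (i : Fin n) (p : ℝ × (Fin n → ℝ)) : ℝ :=
  4 * (∑ j, minner (curvST g i j p) (solitonDefect g x0 t0 j p)) + curvSq g p * drift x0 t0 i p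

/-- The spatial vector field whose divergence appears in the local monotonicity formula. -/
def energyFlux (t : ℝ) (i : Fin n) (x : Fin n → ℝ) : ℝ :=
  fluxCoeff g x0 t0 i (t, x) * gauss (x0, t0) x t

variable {g}

lemma contDiff_curvSq (hg : ∀ i, ContDiff ℝ ∞ (g i)) : ContDiff ℝ ∞ (curvSq g) :=
  ContDiff.sum fun i _ => ContDiff.sum fun j _ =>
    contDiff_minner (contDiff_curvST hg i j) (contDiff_curvST hg i j)

lemma dirD_curvSq (hg : ∀ i, ContDiff ℝ ∞ (g i)) (v p : ℝ × (Fin n → ℝ)) :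
    dirD v (curvSq g) p =
      ∑ i, ∑ j, 2 * minner (dirD v (curvST g i j) p) (curvST g i j p) := by
  have hline : HasDerivAt (fun s : ℝ => p + s • v) v 0 := by
    simpa using ((hasDerivAt_id (0 : ℝ)).smul_const v).const_add p
  have h1 := (contDiff_curvSq hg).hasDerivAt_dirD hline
  have h2 : HasDerivAt (fun s : ℝ => curvSq g (p + s • v)) _ 0 :=
    HasDerivAt.fun_sum (u := Finset.univ) fun i _ => HasDerivAt.fun_sum (u := Finset.univ)
      fun j _ => hasDerivAt_minner ((contDiff_curvST hg i j).hasDerivAt_dirD hline)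
        ((contDiff_curvST hg i j).hasDerivAt_dirD hline)
  have := h1.unique h2
  simp only [zero_smul, add_zero] at this
  rw [this]
  refine Finset.sum_congr rfl fun i _ => Finset.sum_congr rfl fun j _ => ?_
  rw [minner_comm (curvST g i j p)]
  ring

lemma contDiff_slice (t : ℝ) : ContDiff ℝ ∞ fun x : Fin n → ℝ => (t, x) := by fun_prop

lemma contDiff_solitonDefect (hg : ∀ i, ContDiff ℝ ∞ (g i)) (t : ℝ) (j : Fin n) :
    ContDiff ℝ ∞ fun x => solitonDefect g x0 t0 j (t, x) :=
  (((hg j).contDiff_dirD _).comp (contDiff_slice t)).sub <| ContDiff.sum fun l _ =>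
    (contDiff_drift x0 t0 l t).smul ((contDiff_curvST hg l j).comp (contDiff_slice t))

lemma contDiff_energyFlux (hg : ∀ i, ContDiff ℝ ∞ (g i)) (t : ℝ) (i : Fin n) :
    ContDiff ℝ ∞ (energyFlux g x0 t0 t i) :=
  ((contDiff_const.mul (ContDiff.sum fun j _ => contDiff_minner
    ((contDiff_curvST hg i j).comp (contDiff_slice t)) (contDiff_solitonDefect x0 t0 hg t j))).add
    (((contDiff_curvSq hg).comp (contDiff_slice t)).mul (contDiff_drift x0 t0 i t))).mul
    (contDiff_gauss x0 t0 t)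

lemma hasDerivAt_spaceLine (t : ℝ) (x : Fin n → ℝ) (i : Fin n) :
    HasDerivAt (fun s : ℝ => (t, x + s • (Pi.single i 1 : Fin n → ℝ))) (spaceDir i) 0 := by
  have := ((hasDerivAt_id (0 : ℝ)).smul_const (Pi.single i 1 : Fin n → ℝ)).const_add x
  simpa [spaceDir] using (hasDerivAt_const (0 : ℝ) t).prodMk this

lemma ContDiff.hasDerivAt_spaceLine {F : Type*} [NormedAddCommGroup F] [NormedSpace ℝ F]
    {f : ℝ × (Fin n → ℝ) → F} (hf : ContDiff ℝ ∞ f) (t : ℝ) (x : Fin n → ℝ) (i : Fin n) :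
    HasDerivAt (fun s : ℝ => f (t, x + s • (Pi.single i 1 : Fin n → ℝ)))
      (dirD (spaceDir i) f (t, x)) 0 := by
  simpa using hf.hasDerivAt_dirD (_root_.hasDerivAt_spaceLine t x i)

lemma hasDerivAt_fluxCoeff (hg : ∀ i, ContDiff ℝ ∞ (g i))
    (hskew : ∀ i p a b, g i p b a = -g i p a b) (t : ℝ) (x : Fin n → ℝ) (i : Fin n) :
    HasDerivAt (fun s : ℝ => fluxCoeff g x0 t0 i (t, x + s • Pi.single i 1))
      ((4 * ∑ j, (minner (covST g i (curvST g i j) (t, x)) (solitonDefect g x0 t0 j (t, x)) +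
          minner (curvST g i j (t, x)) (covST g i (dirD (timeDir n) (g j)) (t, x) -
            ((1 / (2 * (t0 - t))) • curvST g i j (t, x) +
              ∑ l, drift x0 t0 l (t, x) • covST g i (curvST g l j) (t, x))))) +
        ((∑ j, ∑ m, 2 * minner (covST g i (curvST g j m) (t, x)) (curvST g j m (t, x))) *
            drift x0 t0 i (t, x) + curvSq g (t, x) * (1 / (2 * (t0 - t))))) 0 := by
  have hF : ∀ j m, HasDerivAt
      (fun s : ℝ => curvST g j m (t, x + s • (Pi.single i 1 : Fin n → ℝ)))
      (dirD (spaceDir i) (curvST g j m) (t, x)) 0 := fun j m =>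
    (contDiff_curvST hg j m).hasDerivAt_spaceLine t x i
  have hW : ∀ j, HasDerivAt
      (fun s : ℝ => solitonDefect g x0 t0 j (t, x + s • (Pi.single i 1 : Fin n → ℝ)))
      (dirD (spaceDir i) (dirD (timeDir n) (g j)) (t, x) -
        ((1 / (2 * (t0 - t))) • curvST g i j (t, x) +
          ∑ l, drift x0 t0 l (t, x) • dirD (spaceDir i) (curvST g l j) (t, x))) 0 := by
    intro j
    have h := (((hg j).contDiff_dirD (timeDir n)).hasDerivAt_spaceLine t x i).fun_sub
      (HasDerivAt.fun_sum (u := Finset.univ) fun l _ =>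
        (hasDerivAt_drift_space x0 t0 x t i l).fun_smul (hF l j))
    refine h.congr_deriv ?_
    simp [Finset.sum_add_distrib, ite_smul, add_comm]
  have hq : HasDerivAt (fun s : ℝ => curvSq g (t, x + s • (Pi.single i 1 : Fin n → ℝ)))
      (∑ j, ∑ m, 2 * minner (covST g i (curvST g j m) (t, x)) (curvST g j m (t, x))) 0 := by
    have h := HasDerivAt.fun_sum (u := Finset.univ) fun j _ =>
      HasDerivAt.fun_sum (u := Finset.univ) fun m _ =>
        hasDerivAt_minner_cov (hskew i (t, x)) (hF j m) (hF j m)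
    refine h.congr_deriv ?_
    refine Finset.sum_congr rfl fun j _ => Finset.sum_congr rfl fun m _ => ?_
    simp only [zero_smul, add_zero, covST]
    rw [minner_comm (curvST g j m (t, x))]
    ring
  have hFW := HasDerivAt.fun_sum (u := Finset.univ) fun j _ =>
    hasDerivAt_minner_cov (hskew i (t, x)) (hF i j) (hW j)
  have h := (hFW.const_mul 4).fun_add (hq.fun_mul (hasDerivAt_drift_space x0 t0 x t i i))
  refine h.congr_deriv ?_
  simp only [zero_smul, add_zero, if_true]
  congr 2
  refine Finset.sum_congr rfl fun j _ => ?_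
  congr 2
  simp only [covST, solitonDefect]
  simp only [← mbraL_apply, map_sub, map_sum, map_smul, smul_add, Finset.sum_add_distrib]
  abel

lemma fderiv_energyFlux (hg : ∀ i, ContDiff ℝ ∞ (g i))
    (hskew : ∀ i p a b, g i p b a = -g i p a b) {t : ℝ} (ht : t < t0) (x : Fin n → ℝ)
    (i : Fin n) :
    fderiv ℝ (energyFlux g x0 t0 t i) x (Pi.single i 1) =
      (((4 * ∑ j, (minner (covST g i (curvST g i j) (t, x)) (solitonDefect g x0 t0 j (t, x)) +
          minner (curvST g i j (t, x)) (covST g i (dirD (timeDir n) (g j)) (t, x) -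
            ((1 / (2 * (t0 - t))) • curvST g i j (t, x) +
              ∑ l, drift x0 t0 l (t, x) • covST g i (curvST g l j) (t, x))))) +
        ((∑ j, ∑ m, 2 * minner (covST g i (curvST g j m) (t, x)) (curvST g j m (t, x))) *
            drift x0 t0 i (t, x) + curvSq g (t, x) * (1 / (2 * (t0 - t))))) -
        drift x0 t0 i (t, x) * fluxCoeff g x0 t0 i (t, x)) * gauss (x0, t0) x t := by
  have h1 : HasLineDerivAt ℝ (energyFlux g x0 t0 t i) _ x (Pi.single i 1) :=
    (hasDerivAt_fluxCoeff x0 t0 hg hskew t x i).fun_mul (hasDerivAt_gauss_space x0 t0 x ht i)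
  rw [← ((contDiff_energyFlux x0 t0 hg t i).differentiable (by simp)).differentiableAt
    |>.lineDeriv_eq_fderiv, h1.lineDeriv]
  simp only [zero_smul, add_zero]
  ring

/-- The time derivative of `|F|² G`, minus its `2 / (t₀ - t)` multiple, is a divergence minus a
nonnegative term. -/
lemma local_monotonicity (hg : ∀ i, ContDiff ℝ ∞ (g i))
    (hskew : ∀ i p a b, g i p b a = -g i p a b) {t : ℝ} (ht : t < t0) (x : Fin n → ℝ)
    (hYM : ∀ j, dirD (timeDir n) (g j) (t, x) = ∑ i, covST g i (curvST g i j) (t, x)) :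
    (dirD (timeDir n) (curvSq g) (t, x) + curvSq g (t, x) *
        (n * (1 / (2 * (t0 - t))) - ∑ i, drift x0 t0 i (t, x) ^ 2)) * gauss (x0, t0) x t =
      2 / (t0 - t) * (curvSq g (t, x) * gauss (x0, t0) x t) -
        4 * (∑ j, minner (solitonDefect g x0 t0 j (t, x)) (solitonDefect g x0 t0 j (t, x))) *
          gauss (x0, t0) x t +
        ∑ i, fderiv ℝ (energyFlux g x0 t0 t i) x (Pi.single i 1) := by
  have key := curvature_divergence_algebra (fun i j => curvST g i j (t, x))
    (fun l i j => covST g l (curvST g i j) (t, x)) (fun j => dirD (timeDir n) (g j) (t, x))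
    (fun i j => covST g i (dirD (timeDir n) (g j)) (t, x)) (fun i => drift x0 t0 i (t, x))
    (1 / (2 * (t0 - t))) (fun i j => curvST_swap i j _) (fun l i j => covST_curvST_swap l i j _)
    (fun l i j => bianchi hg l i j _) hYM (fun j => solitonDefect g x0 t0 j (t, x))
    (fun j => rfl) (curvSq g (t, x)) rfl
  simp only [fderiv_energyFlux x0 t0 hg hskew ht, dirD_curvSq hg, dirD_curvST_eq_covST hg]
  rw [← Finset.sum_mul, key]
  have : 4 * (1 / (2 * (t0 - t))) = 2 / (t0 - t) := by
    have : t0 - t ≠ 0 := (sub_pos.2 ht).ne'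
    field_simp; ring
  rw [this]
  simp only [fluxCoeff]
  ring

end Flux

section Integration

variable {n k : ℕ}

lemma dirD_eq_zero_of_notMem {F : Type*} [NormedAddCommGroup F] [NormedSpace ℝ F]
    {K : Set (Fin n → ℝ)} (hK : IsClosed K) {f : ℝ × (Fin n → ℝ) → F}
    (hf : ∀ p, p.2 ∉ K → f p = 0) (v : ℝ × (Fin n → ℝ)) (p : ℝ × (Fin n → ℝ)) (hp : p.2 ∉ K) :
    dirD v f p = 0 := by
  refine dirD_eq_zero_of_eventuallyEq ?_ v
  filter_upwards [(hK.isOpen_compl.preimage continuous_snd).mem_nhds hp] with q hq using hf q hq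

lemma curvST_eq_zero_of_notMem {K : Set (Fin n → ℝ)} (hK : IsClosed K)
    {g : Fin n → ℝ × (Fin n → ℝ) → Mat k} (hg : ∀ i p, p.2 ∉ K → g i p = 0) (i j : Fin n)
    (p : ℝ × (Fin n → ℝ)) (hp : p.2 ∉ K) : curvST g i j p = 0 := by
  simp [curvST, dirD_eq_zero_of_notMem hK (hg _) _ p hp, hg _ p hp, ← mbraL_apply]

lemma integrable_fderiv_apply {f : (Fin n → ℝ) → ℝ} (hf : ContDiff ℝ ∞ f)
    (hc : HasCompactSupport f) (v : Fin n → ℝ) : Integrable fun x => fderiv ℝ f x v :=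
  ((hf.continuous_fderiv (by simp)).clm_apply continuous_const).integrable_of_hasCompactSupport
    (hc.fderiv_apply ℝ v)

lemma integral_fderiv_apply_eq_zero {f : (Fin n → ℝ) → ℝ} (hf : ContDiff ℝ ∞ f)
    (hc : HasCompactSupport f) (v : Fin n → ℝ) : ∫ x, fderiv ℝ f x v = 0 := by
  have := integral_mul_fderiv_eq_neg_fderiv_mul_of_integrable (μ := volume) (𝕜 := ℝ)
    (f := fun _ : Fin n → ℝ => (1 : ℝ)) (g := f) (v := v) (by simp)
    (by simpa using integrable_fderiv_apply hf hc v)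
    (by simpa using hf.continuous.integrable_of_hasCompactSupport hc)
    (fun _ _ => differentiableAt_const _)
    (fun _ _ => (hf.differentiable (by simp)).differentiableAt)
  simpa using this

lemma integrable_slice {Q : ℝ → (Fin n → ℝ) → ℝ} {K : Set (Fin n → ℝ)} (hK : IsCompact K)
    {t t0 : ℝ} (ht : t < t0)
    (hQ : ContinuousOn (fun p : ℝ × (Fin n → ℝ) => Q p.1 p.2) {p | p.1 < t0})
    (h0 : ∀ s x, x ∉ K → Q s x = 0) : Integrable (Q t) :=
  Continuous.integrable_of_hasCompactSupport
    (hQ.comp_continuous (f := fun x => (t, x)) (by fun_prop) fun _ => ht)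
    (HasCompactSupport.intro hK (h0 t))

lemma hasDerivAt_integral_of_compactSupport {Q Q' : ℝ → (Fin n → ℝ) → ℝ}
    {K : Set (Fin n → ℝ)} (hK : IsCompact K) {t t0 : ℝ} (ht : t < t0)
    (hQ : ContinuousOn (fun p : ℝ × (Fin n → ℝ) => Q p.1 p.2) {p | p.1 < t0})
    (hQ' : ContinuousOn (fun p : ℝ × (Fin n → ℝ) => Q' p.1 p.2) {p | p.1 < t0})
    (hd : ∀ s < t0, ∀ x, HasDerivAt (fun u => Q u x) (Q' s x) s)
    (h0 : ∀ s x, x ∉ K → Q s x = 0) (h0' : ∀ s x, x ∉ K → Q' s x = 0) :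
    HasDerivAt (fun s => ∫ x, Q s x) (∫ x, Q' t x) t := by
  have hsub : ∀ s ∈ Icc (t - 1) ((t + t0) / 2), s < t0 := fun s hs => by linarith [hs.2]
  obtain ⟨C, hC⟩ := (isCompact_Icc.prod hK).exists_bound_of_continuousOn
    (hQ'.mono fun p hp => hsub p.1 hp.1 : ContinuousOn _ (Icc (t - 1) ((t + t0) / 2) ×ˢ K))
  refine (hasDerivAt_integral_of_dominated_loc_of_deriv_le (s := Icc (t - 1) ((t + t0) / 2))
    (bound := K.indicator fun _ => C) (Icc_mem_nhds (by linarith) (by linarith)) ?_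
    (integrable_slice hK ht hQ h0) (integrable_slice hK ht hQ' h0').aestronglyMeasurable
    (Eventually.of_forall fun x s hs => ?_) ?_
    (Eventually.of_forall fun x s hs => hd s (hsub s hs) x)).2
  · filter_upwards [Iio_mem_nhds ht] with s hs
    exact (integrable_slice hK hs hQ h0).aestronglyMeasurable
  · by_cases hx : x ∈ K
    · simpa [hx] using hC (s, x) ⟨hs, hx⟩
    · simp [hx, h0' s x hx]
  · exact (integrable_indicator_iff hK.measurableSet).2
      (integrableOn_const hK.measure_lt_top.ne)

variable {g : Fin n → ℝ × (Fin n → ℝ) → Mat k} {K : Set (Fin n → ℝ)} {t0 : ℝ}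

/-- The Gaussian weighted energy. -/
def gaussEnergy (g : Fin n → ℝ × (Fin n → ℝ) → Mat k) (x0 : Fin n → ℝ) (t0 t : ℝ) : ℝ :=
  ∫ x, curvSq g (t, x) * gauss (x0, t0) x t

lemma exists_hasDerivAt_gaussEnergy (hg : ∀ i, ContDiff ℝ ∞ (g i))
    (hskew : ∀ i p a b, g i p b a = -g i p a b) (hK : IsCompact K)
    (hsupp : ∀ i p, p.2 ∉ K → g i p = 0) (x0 : Fin n → ℝ) {t : ℝ} (ht : t < t0)
    (hYM : ∀ x j, dirD (timeDir n) (g j) (t, x) = ∑ i, covST g i (curvST g i j) (t, x)) :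
    ∃ E', HasDerivAt (gaussEnergy g x0 t0) E' t ∧
      E' ≤ 2 / (t0 - t) * gaussEnergy g x0 t0 t := by
  have hF := curvST_eq_zero_of_notMem hK.isClosed hsupp
  have hq0 : ∀ p, p.2 ∉ K → curvSq g p = 0 := fun p hp => by
    simp [curvSq, hF _ _ p hp, ← minnerL_apply]
  have hcq := contDiff_curvSq hg
  have hQ : ContinuousOn (fun p : ℝ × (Fin n → ℝ) =>
      curvSq g (p.1, p.2) * gauss (x0, t0) p.2 p.1) {p | p.1 < t0} :=
    hcq.continuous.continuousOn.mul (continuousOn_gauss x0 t0)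
  let Q' : ℝ → (Fin n → ℝ) → ℝ := fun s x =>
    (dirD (timeDir n) (curvSq g) (s, x) + curvSq g (s, x) *
      (n * (1 / (2 * (t0 - s))) - ∑ i, drift x0 t0 i (s, x) ^ 2)) * gauss (x0, t0) x s
  have hQ' : ContinuousOn (fun p : ℝ × (Fin n → ℝ) => Q' p.1 p.2) {p | p.1 < t0} := by
    refine (((hcq.contDiff_dirD (timeDir n)).continuous.continuousOn).add
      (hcq.continuous.continuousOn.mul (ContinuousOn.sub ?_ ?_))).mul (continuousOn_gauss x0 t0)
    · refine continuousOn_const.mul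
        (ContinuousOn.div continuousOn_const (by fun_prop) fun p hp => ?_)
      have : 0 < t0 - p.1 := sub_pos.2 hp
      positivity
    · exact continuousOn_finsetSum _ fun i _ => (continuousOn_drift x0 t0 i).pow 2
  have h0' : ∀ s x, x ∉ K → Q' s x = 0 := fun s x hx => by
    simp [Q', hq0 (s, x) hx, dirD_eq_zero_of_notMem hK.isClosed hq0 _ (s, x) hx]
  have hd : ∀ s < t0, ∀ x, HasDerivAt (fun u => curvSq g (u, x) * gauss (x0, t0) x u)
      (Q' s x) s := fun s hs x => by
    have hline : HasDerivAt (fun u : ℝ => (u, x)) (timeDir n) s :=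
      (hasDerivAt_id s).prodMk (hasDerivAt_const s x)
    refine ((hcq.hasDerivAt_dirD hline).fun_mul
      (hasDerivAt_gauss_time x0 t0 x hs)).congr_deriv ?_
    simp only [Q']
    ring
  have h0 : ∀ s x, x ∉ K → curvSq g (s, x) * gauss (x0, t0) x s = 0 := fun s x hx => by
    simp [hq0 (s, x) hx]
  refine ⟨_, hasDerivAt_integral_of_compactSupport hK ht hQ hQ' hd h0 h0', ?_⟩
  have hflux : ∀ i, HasCompactSupport (energyFlux g x0 t0 t i) := fun i =>
    HasCompactSupport.intro hK fun x hx => by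
      simp [energyFlux, fluxCoeff, hF _ _ (t, x) hx, hq0 (t, x) hx, ← minnerL_apply]
  have hsm := contDiff_energyFlux x0 t0 hg t
  have hIQ := (integrable_slice hK ht hQ h0).const_mul (2 / (t0 - t))
  have hIdiv : Integrable fun x => ∑ i, fderiv ℝ (energyFlux g x0 t0 t i) x (Pi.single i 1) :=
    integrable_finsetSum _ fun i _ => integrable_fderiv_apply (hsm i) (hflux i) _
  calc ∫ x, Q' t x ≤ ∫ x, (2 / (t0 - t) * (curvSq g (t, x) * gauss (x0, t0) x t) +
        ∑ i, fderiv ℝ (energyFlux g x0 t0 t i) x (Pi.single i 1)) := by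
        refine integral_mono (integrable_slice hK ht hQ' h0') (hIQ.add hIdiv) fun x => ?_
        have hW : 0 ≤ ∑ j, minner (solitonDefect g x0 t0 j (t, x))
            (solitonDefect g x0 t0 j (t, x)) :=
          Finset.sum_nonneg fun _ _ => minner_self_nonneg _
        have := mul_nonneg hW (gauss_nonneg x0 t0 x ht)
        simp only [Q', local_monotonicity x0 t0 hg hskew ht x (hYM x)]
        linarith
    _ = 2 / (t0 - t) * gaussEnergy g x0 t0 t := by
        rw [integral_add hIQ hIdiv, integral_const_mul, integral_finsetSum _ fun i _ =>
          integrable_fderiv_apply (hsm i) (hflux i) _]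
        simp [integral_fderiv_apply_eq_zero (hsm _) (hflux _), gaussEnergy]

lemma continuousOn_gaussEnergy {x0 : Fin n → ℝ} {I : Set ℝ}
    (hE : ∀ t ∈ I, ∃ E', HasDerivAt (gaussEnergy g x0 t0) E' t ∧
      E' ≤ 2 / (t0 - t) * gaussEnergy g x0 t0 t) : ContinuousOn (gaussEnergy g x0 t0) I :=
  fun t ht => (hE t ht).choose_spec.1.continuousAt.continuousWithinAt

/-- The scale invariant energy `(t₀ - t)² ∫ |F|² G` is nonincreasing along the flow. -/
lemma antitoneOn_sq_mul_gaussEnergy {x0 : Fin n → ℝ}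
    (hE : ∀ t ∈ Ioo 0 t0, ∃ E', HasDerivAt (gaussEnergy g x0 t0) E' t ∧
      E' ≤ 2 / (t0 - t) * gaussEnergy g x0 t0 t) :
    AntitoneOn (fun t => (t0 - t) ^ 2 * gaussEnergy g x0 t0 t) (Ioo 0 t0) := by
  have hd : ∀ t ∈ Ioo 0 t0, ∃ D, HasDerivAt (fun t => (t0 - t) ^ 2 * gaussEnergy g x0 t0 t) D t ∧
      D ≤ 0 := by
    intro t ht
    obtain ⟨E', hE', hle⟩ := hE t ht
    refine ⟨_, (((hasDerivAt_id t).const_sub t0).fun_pow 2).fun_mul hE', ?_⟩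
    have hτ : 0 < t0 - t := sub_pos.2 ht.2
    have := mul_le_mul_of_nonneg_left hle (sq_nonneg (t0 - t))
    have h2 : (t0 - t) ^ 2 * (2 / (t0 - t) * gaussEnergy g x0 t0 t) =
        2 * (t0 - t) * gaussEnergy g x0 t0 t := by field_simp
    simp only [id]
    norm_num
    linarith
  choose! D hD hD0 using hd
  refine antitoneOn_of_deriv_nonpos (convex_Ioo 0 t0)
    (fun t ht => (hD t ht).continuousAt.continuousWithinAt) ?_ ?_
  · intro t ht
    rw [interior_Ioo] at ht
    exact (hD t ht).differentiableAt.differentiableWithinAt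
  · intro t ht
    rw [interior_Ioo] at ht
    rw [(hD t ht).deriv]
    exact hD0 t ht

/-- Averaging a monotone scale invariant quantity over parabolic annuli gives a monotone one. -/
lemma sq_mul_integral_mono {h : ℝ → ℝ} {t0 ρ r : ℝ} (hcont : ContinuousOn h (Ioo 0 t0))
    (hanti : AntitoneOn (fun t => (t0 - t) ^ 2 * h t) (Ioo 0 t0)) (hρ : 0 < ρ) (hρr : ρ ≤ r)
    (hr : 4 * r ^ 2 < t0) :
    ρ ^ 2 / 2 * ∫ t in Icc (t0 - 4 * ρ ^ 2) (t0 - ρ ^ 2), h t ≤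
      r ^ 2 / 2 * ∫ t in Icc (t0 - 4 * r ^ 2) (t0 - r ^ 2), h t := by
  have hmem : ∀ R, 0 < R → R ≤ r → ∀ u ∈ Icc (1 : ℝ) 4, t0 - R ^ 2 * u ∈ Ioo 0 t0 := by
    intro R hR hRr u hu
    have h1 : R ^ 2 ≤ r ^ 2 := by gcongr
    have h2 : 0 < R ^ 2 := by positivity
    constructor <;> nlinarith [hu.1, hu.2]
  have hscale : ∀ R, 0 < R → R ^ 2 / 2 * ∫ t in Icc (t0 - 4 * R ^ 2) (t0 - R ^ 2), h t =
      ∫ u in (1 : ℝ)..4, R ^ 4 / 2 * h (t0 - R ^ 2 * u) := by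
    intro R hR
    have hR2 : 0 < R ^ 2 := by positivity
    rw [integral_Icc_eq_integral_Ioc, ← intervalIntegral.integral_of_le (by linarith),
      intervalIntegral.integral_const_mul, intervalIntegral.integral_comp_sub_mul _ hR2.ne']
    rw [mul_one, mul_comm (R ^ 2) 4, smul_eq_mul]
    field_simp
  have hint : ∀ R, 0 < R → R ≤ r →
      IntervalIntegrable (fun u => R ^ 4 / 2 * h (t0 - R ^ 2 * u)) volume 1 4 := by
    intro R hR hRr
    refine ContinuousOn.intervalIntegrable ?_
    rw [uIcc_of_le (by norm_num)]
    exact continuousOn_const.mul (hcont.comp (by fun_prop) (hmem R hR hRr))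
  have hr0 : 0 < r := hρ.trans_le hρr
  rw [hscale ρ hρ, hscale r hr0]
  refine intervalIntegral.integral_mono_on (by norm_num) (hint ρ hρ hρr) (hint r hr0 le_rfl)
    fun u hu => ?_
  have hu0 : 0 < u := by linarith [hu.1]
  have := hanti (hmem r hr0 le_rfl u hu) (hmem ρ hρ hρr u hu) (by gcongr)
  simp only [sub_sub_cancel, mul_pow] at this
  have hu2 : 0 < u ^ 2 := by positivity
  refine le_of_mul_le_mul_right ?_ hu2
  linarith

end Integration

section Translation

variable {n k : ℕ}

lemma pd_slice_eq_dirD {F : Type*} [NormedAddCommGroup F] [NormedSpace ℝ F]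
    {f : ℝ × (Fin n → ℝ) → F} (hf : ContDiff ℝ ∞ f) (t : ℝ) (x : Fin n → ℝ) (i : Fin n) :
    pd (fun y => f (t, y)) x i = dirD (spaceDir i) f (t, x) := by
  have h : DifferentiableAt ℝ (fun y => f (t, y)) x :=
    ((hf.comp (contDiff_slice t)).differentiable (by simp)).differentiableAt
  have hl : HasLineDerivAt ℝ (fun y => f (t, y)) _ x (Pi.single i 1) :=
    hf.hasDerivAt_spaceLine t x i
  rw [pd, ← h.lineDeriv_eq_fderiv, hl.lineDeriv]

/-- The `i`-th component of a connection as a function on spacetime. -/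
def Conn.component (Γ : Conn n k) (i : Fin n) (p : ℝ × (Fin n → ℝ)) : Mat k := Γ p.1 p.2 i

lemma IsSmoothConn.contDiff_component {Γ : Conn n k} (h : IsSmoothConn Γ) (i : Fin n) :
    ContDiff ℝ ∞ (Conn.component Γ i) :=
  contDiff_pi.1 h.1 i

lemma curv_eq_curvST {Γ : Conn n k} (h : IsSmoothConn Γ) (t : ℝ) (x : Fin n → ℝ) (i j : Fin n) :
    curv Γ t x i j = curvST (Conn.component Γ) i j (t, x) := by
  rw [curvST, ← pd_slice_eq_dirD (h.contDiff_component j),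
    ← pd_slice_eq_dirD (h.contDiff_component i)]
  rfl

lemma covD_curv_eq_covST {Γ : Conn n k} (h : IsSmoothConn Γ) (t : ℝ) (x : Fin n → ℝ)
    (l i j : Fin n) :
    covD Γ t (fun y => curv Γ t y i j) x l =
      covST (Conn.component Γ) l (curvST (Conn.component Γ) i j) (t, x) := by
  simp only [covD, curv_eq_curvST h]
  rw [pd_slice_eq_dirD (contDiff_curvST h.contDiff_component i j)]
  rfl

lemma tderiv_eq_dirD {Γ : Conn n k} (h : IsSmoothConn Γ) (t : ℝ) (x : Fin n → ℝ) (j : Fin n) :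
    tderiv Γ t x j = dirD (timeDir n) (Conn.component Γ j) (t, x) :=
  ((h.contDiff_component j).hasDerivAt_dirD
    ((hasDerivAt_id t).prodMk (hasDerivAt_const t x))).deriv

lemma Psi_eq_gaussEnergy {Γ : Conn n k} (h : IsSmoothConn Γ) (x0 : Fin n → ℝ) (t0 R : ℝ) :
    Psi Γ (x0, t0) R = R ^ 2 / 2 * ∫ t in Icc (t0 - 4 * R ^ 2) (t0 - R ^ 2),
      gaussEnergy (Conn.component Γ) x0 t0 t := by
  simp only [Psi, gaussEnergy, normF2, msq, curv_eq_curvST h, curvSq]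

end Translation

/-- Monotonicity of the entropy `Ψ` along Yang–Mills flow on `ℝⁿ`:
for `0 < ρ ≤ r < √t₀/2` one has `Ψ_{z₀}(ρ;Γ) ≤ Ψ_{z₀}(r;Γ)`. -/
theorem entropy_Psi_monotonicity
    (n k : ℕ) (hn : 2 ≤ n) (hk : 1 ≤ k) (T : ℝ)
    (Γ : Conn n k) (hsm : IsSmoothConn Γ) (hflow : IsYMFlowOn Γ (Ico 0 T))
    (K : Set (Fin n → ℝ)) (hK : IsCompact K) (hsupp : SuppIn Γ K)
    (x0 : Fin n → ℝ) (t0 : ℝ) (ht0 : t0 ∈ Ioo 0 T)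
    (ρ r : ℝ) (hρ : 0 < ρ) (hρr : ρ ≤ r) (hr : r < Real.sqrt t0 / 2) :
    Psi Γ (x0, t0) ρ ≤ Psi Γ (x0, t0) r := by
  have hE : ∀ t ∈ Ioo 0 t0, ∃ E', HasDerivAt (gaussEnergy (Conn.component Γ) x0 t0) E' t ∧
      E' ≤ 2 / (t0 - t) * gaussEnergy (Conn.component Γ) x0 t0 t := by
    intro t ht
    refine exists_hasDerivAt_gaussEnergy hsm.contDiff_component
      (fun i p a b => hsm.2 p.1 p.2 i a b) hK
      (fun i p hp => congrFun (hsupp p.1 p.2 hp) i) x0 ht.2 fun x j => ?_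
    have := hflow t ⟨ht.1.le, ht.2.trans ht0.2⟩ x j
    simpa only [tderiv_eq_dirD hsm, covD_curv_eq_covST hsm] using this
  rw [Psi_eq_gaussEnergy hsm, Psi_eq_gaussEnergy hsm]
  refine sq_mul_integral_mono (continuousOn_gaussEnergy hE) (antitoneOn_sq_mul_gaussEnergy hE)
    hρ hρr ?_
  have h1 : 2 * r < Real.sqrt t0 := by linarith
  have h2 := Real.sq_sqrt ht0.1.le
  nlinarith [hρ.trans_le hρr]

end
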